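/- For every integer 𝔰 ≥ 2 and every real p with 0 < p < 1, Σ_{x=𝔰−1}^∞ f_{𝔰,p}(x)/x = p/(𝔰−1). Equivalently, E[(𝔰−1)/(M−1)] = p: the alive particle filter estimator of a single success probability is unbiased. -/

import Mathlib

/-- The probability mass function of `X = M - 1`, where `M` is the number of i.i.d.
Bernoulli(`p`) trials needed to obtain `𝔰` successes (a shifted negative binomial):
`f_{𝔰,p}(x) = (x! / ((𝔰−1)!·(x+1−𝔰)!))·p^𝔰·(1−p)^{x+1−𝔰}` for integers `x ≥ 𝔰 − 1`. -/
noncomputable def nbPMF (𝔰 : ℕ) (p : ℝ) (x : ℕ) : ℝ :=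
  (Nat.factorial x : ℝ) /
      ((Nat.factorial (𝔰 - 1) : ℝ) * (Nat.factorial (x + 1 - 𝔰) : ℝ)) *
    p ^ 𝔰 * (1 - p) ^ (x + 1 - 𝔰)

/-- Cancelling the factor `n + k + 1` in the probability mass function at `n + k + 1`. -/
theorem nbPMF_div_eq_choose (k n : ℕ) (p : ℝ) :
    nbPMF (k + 2) p (n + (k + 1)) / ((n + (k + 1) : ℕ) : ℝ)
      = p ^ (k + 2) / ((k : ℝ) + 1) * (((n + k).choose k : ℝ) * (1 - p) ^ n) := by
  have h₁ : n + (k + 1) + 1 - (k + 2) = n := by omega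
  have h₂ : k + 2 - 1 = k + 1 := rfl
  have h₃ : ((n + k).choose k : ℝ) * k.factorial * n.factorial = (n + k).factorial := by
    rw [mul_right_comm]
    exact_mod_cast Nat.add_choose_mul_factorial_mul_factorial n k
  have h₄ : (n : ℝ) + (k + 1) ≠ 0 := by positivity
  have h₅ : (k : ℝ) + 1 ≠ 0 := by positivity
  have h₆ : (k.factorial : ℝ) ≠ 0 := by positivity
  have h₇ : (n.factorial : ℝ) ≠ 0 := by positivity
  rw [nbPMF, h₁, h₂, ← add_assoc n k 1, Nat.factorial_succ, Nat.factorial_succ]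
  push_cast
  rw [← h₃, add_assoc (n : ℝ) k 1]
  field_simp

/-- The first inverse moment of the shifted negative binomial distribution, as a convergent
series. -/
theorem hasSum_nbPMF_div (k : ℕ) {p : ℝ} (hp0 : 0 < p) (hp1 : p < 1) :
    HasSum (fun x : ℕ => if k + 1 ≤ x then nbPMF (k + 2) p x / (x : ℝ) else 0)
      (p / ((k : ℝ) + 1)) := by
  have hr : ‖1 - p‖ < 1 := by
    rw [Real.norm_eq_abs, abs_lt]
    constructor <;> linarith
  have h := (hasSum_choose_mul_geometric_of_norm_lt_one k hr).mul_left
    (p ^ (k + 2) / ((k : ℝ) + 1))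
  have hval : p ^ (k + 2) / ((k : ℝ) + 1) * (1 / (1 - (1 - p)) ^ (k + 1))
      = p / ((k : ℝ) + 1) := by
    have : (k : ℝ) + 1 ≠ 0 := by positivity
    rw [sub_sub_cancel, pow_succ p (k + 1)]
    field_simp
  rw [hval] at h
  refine ((add_left_injective (k + 1)).hasSum_iff fun x hx => if_neg fun hle => hx ?_).mp ?_
  · exact ⟨x - (k + 1), Nat.sub_add_cancel hle⟩
  · refine h.congr_fun fun n => ?_
    simp only [Function.comp_apply, le_add_iff_nonneg_left, zero_le, if_true]
    exact nbPMF_div_eq_choose k n p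

/-- **Unbiasedness of the alive particle filter for a single success probability**:
for every integer `𝔰 ≥ 2` and `0 < p < 1`,
`∑_{x ≥ 𝔰−1} f_{𝔰,p}(x)/x = p/(𝔰−1)`, i.e. `E[(𝔰−1)/(M−1)] = p`. -/
theorem nbPMF_first_inverse_moment (𝔰 : ℕ) (h𝔰 : 2 ≤ 𝔰) (p : ℝ)
    (hp0 : 0 < p) (hp1 : p < 1) :
    (∑' x : ℕ, if 𝔰 - 1 ≤ x then nbPMF 𝔰 p x / (x : ℝ) else 0)
      = p / ((𝔰 : ℝ) - 1) := by
  obtain ⟨k, rfl⟩ := Nat.exists_eq_add_of_le' h𝔰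
  have hk : ((k + 2 : ℕ) : ℝ) - 1 = (k : ℝ) + 1 := by
    push_cast
    ring
  rw [hk]
  exact (hasSum_nbPMF_div k hp0 hp1).tsum_eq
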